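/- arXiv:1612.04871 — 5 statements merged into one kernel-verified Lean document; each statement's English description precedes it below -/
import Mathlib

section
/- Let m, n be natural numbers and let M be an m×n integer matrix, inducing the ℤ-linear map f : ℤⁿ → ℤᵐ, v ↦ M·v. Equip ℝᵐ with the standard Euclidean inner product. Let I ⊆ {1,…,n} be a set of column indices such that the columns {M·eᵢ : i ∈ I}, viewed in ℝᵐ, form a basis of the ℝ-linear span of all the columns of M. Then the torsion subgroup of the cokernel ℤᵐ/f(ℤⁿ) is finite of cardinality at most ∏_{i∈I} ‖M·eᵢ‖, where ‖M·eᵢ‖ = (∑_{j=1}^m M_{j,i}²)^{1/2} is the Euclidean norm of the i-th column. -/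
open Module

/-- **Hadamard's inequality**: the determinant of a real matrix is at most, in absolute value, the
product of the Euclidean norms of its columns. -/
theorem Matrix.abs_det_le_prod_sqrt_col {m : ℕ} (A : Matrix (Fin m) (Fin m) ℝ) :
    |A.det| ≤ ∏ i, Real.sqrt (∑ j, A j i ^ 2) := by
  have : Fact (finrank ℝ (EuclideanSpace ℝ (Fin m)) = m) := ⟨by simp⟩
  let b := EuclideanSpace.basisFun (Fin m) ℝ
  have h := b.toBasis.orientation.abs_volumeForm_apply_le fun i => WithLp.toLp 2 fun j => A j i
  rw [b.toBasis.orientation.volumeForm_robust' b, Basis.det_apply] at h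
  convert h using 3 with i
  · ext i j
    simp [b, Basis.toMatrix_apply]
  · simp [EuclideanSpace.norm_eq]

/-- The coordinatewise inclusion of `ℤ^ι` into `ℝ^ι`. -/
noncomputable def intCastPi (ι : Type*) : (ι → ℤ) →ₗ[ℤ] (ι → ℝ) :=
  (Int.castAddHom ℝ).toIntLinearMap.compLeft ι

@[simp]
theorem intCastPi_apply {ι : Type*} (x : ι → ℤ) (j : ι) : intCastPi ι x j = x j := rfl

theorem intCastPi_injective (ι : Type*) : Function.Injective (intCastPi ι) :=
  fun x y h => funext fun j => by simpa using congrFun h j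

theorem intCastPi_mem_span_image {ι : Type*} {s : Set (ι → ℤ)} {x : ι → ℤ}
    (hx : x ∈ Submodule.span ℤ s) : intCastPi ι x ∈ Submodule.span ℝ (intCastPi ι '' s) :=
  Submodule.span_le_restrictScalars ℤ ℝ _ <|
    (Submodule.map_span (intCastPi ι) s).le (Submodule.mem_map_of_mem hx)

/-- A sublattice of `ℤ^m` of full rank has finite index, at most the product of the Euclidean norms
of the vectors of a basis. -/
theorem finite_quotient_span_and_card_le {m : ℕ} {κ : Type*} [Fintype κ]
    (hκ : Fintype.card κ = m) (w : κ → Fin m → ℤ)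
    (hw : LinearIndependent ℝ fun k => intCastPi (Fin m) (w k)) :
    Finite ((Fin m → ℤ) ⧸ Submodule.span ℤ (Set.range w)) ∧
      (Nat.card ((Fin m → ℤ) ⧸ Submodule.span ℤ (Set.range w)) : ℝ) ≤
        ∏ k, Real.sqrt (∑ j, (w k j : ℝ) ^ 2) := by
  let e : κ ≃ Fin m := Fintype.equivFinOfCardEq hκ
  let A : Matrix (Fin m) (Fin m) ℤ := Matrix.of fun j i => w (e.symm i) j
  have hwZ : LinearIndependent ℤ (w ∘ e.symm) :=
    LinearIndependent.of_comp (intCastPi (Fin m))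
      ((hw.comp e.symm e.symm.injective).restrict_scalars' ℤ)
  have hrange : Set.range (w ∘ e.symm) = Set.range w := e.symm.surjective.range_comp w
  have hcard : A.det.natAbs = Nat.card ((Fin m → ℤ) ⧸ Submodule.span ℤ (Set.range w)) := by
    rw [← hrange, ← Submodule.natAbs_det_basis_change (Pi.basisFun ℤ (Fin m)) _ (Basis.span hwZ),
      Basis.det_apply]
    congr 2
    ext i j
    simp [A, Basis.toMatrix_apply, Basis.span_apply]
  have hAR : (A.det : ℝ) = (A.map (Int.cast : ℤ → ℝ)).det := (Int.castRingHom ℝ).map_det A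
  have hne : A.det ≠ 0 := by
    have h : LinearIndependent ℝ (A.map (Int.cast : ℤ → ℝ)).col :=
      hw.comp e.symm e.symm.injective
    have h' := (Matrix.isUnit_iff_isUnit_det _).1 (Matrix.linearIndependent_cols_iff_isUnit.1 h)
    rw [← hAR] at h'
    exact_mod_cast h'.ne_zero
  constructor
  · apply Nat.finite_of_card_ne_zero
    rwa [← hcard, Int.natAbs_ne_zero]
  · rw [← hcard, Nat.cast_natAbs, Int.cast_abs, hAR, ← e.symm.prod_comp]
    exact Matrix.abs_det_le_prod_sqrt_col _


/-- Gabber's lemma (Soulé, Lemma 1): for an integer matrix `M` inducing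
`f : ℤⁿ → ℤᵐ`, and a set `I` of column indices whose columns form a basis of
the real span of all columns, the torsion subgroup of the cokernel `ℤᵐ/f(ℤⁿ)`
is finite of cardinality at most the product of the Euclidean norms of the
columns indexed by `I`. -/
theorem stmt_0 (m n : ℕ) (M : Matrix (Fin m) (Fin n) ℤ) (I : Finset (Fin n))
    (hli : LinearIndependent ℝ (fun i : I => (fun j => (M j i.1 : ℝ) : Fin m → ℝ)))
    (hspan : Submodule.span ℝ ((fun i : Fin n => (fun j => (M j i : ℝ) : Fin m → ℝ)) '' I) =
      Submodule.span ℝ (Set.range (fun i : Fin n => (fun j => (M j i : ℝ) : Fin m → ℝ)))) :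
    (↑(AddCommGroup.torsion ((Fin m → ℤ) ⧸ LinearMap.range (Matrix.mulVecLin M))) :
        Set ((Fin m → ℤ) ⧸ LinearMap.range (Matrix.mulVecLin M))).Finite ∧
    (Nat.card (AddCommGroup.torsion ((Fin m → ℤ) ⧸ LinearMap.range (Matrix.mulVecLin M))) : ℝ)
      ≤ ∏ i ∈ I, Real.sqrt (∑ j, (M j i : ℝ) ^ 2) := by
  classical
  set L := LinearMap.range (Matrix.mulVecLin M) with hL
  let c := intCastPi (Fin m)
  let F : I ⊕ Fin m → Fin m → ℤ := Sum.elim (fun i j => M j i) fun j => Pi.single j 1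
  have hcol : ∀ i, (fun j => M j i) ∈ L := fun i => ⟨Pi.single i 1, by ext; simp⟩
  have hinl : LinearIndepOn ℝ (fun k => c (F k)) (Set.range Sum.inl) :=
    (linearIndepOn_range_iff Sum.inl_injective _).2 hli
  obtain ⟨u, -, hu, hspan_u, hli_u⟩ :=
    exists_linearIndepOn_extension hinl (Set.subset_univ _)
  have htop : Submodule.span ℝ (Set.range fun k : u => c (F k)) = ⊤ := by
    rw [← Set.image_eq_range (fun k => c (F k)) u, eq_top_iff, ← (Pi.basisFun ℝ (Fin m)).span_eq, Submodule.span_le]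
    rintro _ ⟨j, rfl⟩
    convert hspan_u ⟨Sum.inr j, trivial, rfl⟩ using 1
    ext k
    simp [F, c, Pi.single_apply]
  have hcard_u : Fintype.card u = m := by
    simpa using (finrank_eq_card_basis (Basis.mk hli_u htop.ge)).symm
  obtain ⟨hfin, hle⟩ := finite_quotient_span_and_card_le hcard_u (fun k : u => F k) hli_u
  set N := Submodule.span ℤ (Set.range fun k : u => F k) with hN
  have hI : (fun k => c (F k)) '' Set.range Sum.inl =
      (fun i : Fin n => (fun j => (M j i : ℝ) : Fin m → ℝ)) '' I := by
    ext x
    simp [F, c, funext_iff]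
  have hLspan : ∀ x ∈ L, c x ∈ Submodule.span ℝ ((fun k => c (F k)) '' Set.range Sum.inl) := by
    intro x hx
    rw [hL, Matrix.range_mulVecLin] at hx
    rw [hI, hspan]
    convert intCastPi_mem_span_image hx using 2
    rw [← Set.range_comp]
    rfl
  have hsat : ∀ x ∈ N, ∀ d : ℕ, 0 < d → d • x ∈ L → x ∈ L := by
    intro x hx d hd hdx
    have hcx : c x ∈ Submodule.span ℝ ((fun k => c (F k)) '' Set.range Sum.inl) := by
      have h := hLspan _ hdx
      rw [map_nsmul, ← Nat.cast_smul_eq_nsmul ℝ] at h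
      exact (Submodule.smul_mem_iff _ (by positivity)).1 h
    rw [hN, ← Set.image_eq_range, ← Set.union_sdiff_cancel hu, Set.image_union,
      Submodule.span_union, Submodule.mem_sup] at hx
    obtain ⟨a, ha, b, hb, rfl⟩ := hx
    have hca := intCastPi_mem_span_image ha
    have hcb := intCastPi_mem_span_image hb
    rw [Set.image_image] at hca hcb
    have hcb' : c b ∈ Submodule.span ℝ ((fun k => c (F k)) '' Set.range Sum.inl) := by
      rw [map_add] at hcx
      exact (Submodule.add_mem_iff_right _ hca).1 hcx
    have hdisj := ((linearIndepOn_union_iff Set.disjoint_sdiff_right).1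
      ((Set.union_sdiff_cancel hu).symm ▸ hli_u)).2.2
    have hb0 : c b = 0 := Submodule.disjoint_def.1 hdisj _ hcb' hcb
    rw [(map_eq_zero_iff c (intCastPi_injective _)).1 hb0, add_zero]
    refine Submodule.span_le.2 ?_ ha
    rintro _ ⟨_, ⟨i, rfl⟩, rfl⟩
    exact hcol i
  let g : AddCommGroup.torsion ((Fin m → ℤ) ⧸ L) → (Fin m → ℤ) ⧸ N :=
    fun q => Submodule.Quotient.mk q.1.out
  have hg : Function.Injective g := by
    intro p q hpq
    obtain ⟨d, hd, hd0⟩ := isOfFinAddOrder_iff_nsmul_eq_zero.1 (p - q).2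
    have hmk : (Submodule.Quotient.mk (p.1.out - q.1.out) : (Fin m → ℤ) ⧸ L) = p.1 - q.1 := by
      rw [Submodule.Quotient.mk_sub]
      congr 1 <;> exact Quotient.out_eq' _
    have hmem := hsat _ ((Submodule.Quotient.eq N).1 hpq) d hd <| by
      rw [← Submodule.Quotient.mk_eq_zero, Submodule.Quotient.mk_smul, hmk]
      exact hd0
    rw [← Submodule.Quotient.mk_eq_zero, hmk, sub_eq_zero] at hmem
    exact Subtype.ext hmem
  refine ⟨Set.finite_coe_iff.1 (Finite.of_injective g hg), ?_⟩
  calc (Nat.card (AddCommGroup.torsion ((Fin m → ℤ) ⧸ L)) : ℝ)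
      ≤ Nat.card ((Fin m → ℤ) ⧸ N) := by exact_mod_cast Nat.card_le_card_of_injective g hg
    _ ≤ ∏ k : u, Real.sqrt (∑ j, (F k j : ℝ) ^ 2) := hle
    _ = ∏ k, Real.sqrt (∑ j, (F k j : ℝ) ^ 2) := by
      rw [← Finset.prod_subtype u.toFinset (fun _ => Set.mem_toFinset)
        fun k => Real.sqrt (∑ j, (F k j : ℝ) ^ 2)]
      refine Finset.prod_subset (Finset.subset_univ _) ?_
      rintro (i | j) - hk
      · exact absurd (Set.mem_toFinset.2 (hu ⟨i, rfl⟩)) hk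
      · simp [F, Pi.single_apply]
    _ = ∏ i ∈ I, Real.sqrt (∑ j, (M j i : ℝ) ^ 2) := by
      rw [← Finset.prod_coe_sort I, Fintype.prod_sum_type]
      simp [F, Pi.single_apply]
end

section
/- Let m, n be natural numbers, let M be an m×n integer matrix inducing the ℤ-linear map f : ℤⁿ → ℤᵐ, v ↦ M·v, and let K ≥ 1 be a real number such that every column of M has Euclidean norm at most K, i.e. (∑_{j=1}^m M_{j,i}²)^{1/2} ≤ K for every i. Then the torsion subgroup of the cokernel ℤᵐ/f(ℤⁿ) is finite of cardinality at most Kⁿ. -/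
/-- **Hadamard's inequality**: the determinant is bounded by the product of the norms of the rows. -/
theorem Matrix.abs_det_le_prod_sqrt {m : ℕ} (A : Matrix (Fin m) (Fin m) ℝ) :
    |A.det| ≤ ∏ i, Real.sqrt (∑ j, A i j ^ 2) := by
  have : Fact (Module.finrank ℝ (EuclideanSpace ℝ (Fin m)) = m) := ⟨by simp⟩
  let b := EuclideanSpace.basisFun (Fin m) ℝ
  have h := b.toBasis.orientation.abs_volumeForm_apply_le fun i => WithLp.toLp 2 (A i)
  rw [Orientation.volumeForm_robust _ b rfl, Module.Basis.det_apply] at h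
  have hA : b.toBasis.toMatrix (fun i => WithLp.toLp 2 (A i)) = A.transpose := by
    ext i j
    simp [b, Module.Basis.toMatrix_apply]
  simpa [hA, EuclideanSpace.norm_eq] using h

/-- Among a family of vectors in `Fin m → ℝ` together with the standard basis one can choose a basis
which contains a spanning subfamily of the given family. -/
theorem exists_basis_extending_columns {m n : ℕ} (c : Fin n → Fin m → ℝ) :
    ∃ (s : Fin m → Fin n ⊕ Fin m) (B : Module.Basis (Fin m) ℝ (Fin m → ℝ)),
      Function.Injective s ∧ (∀ j, B j = Sum.elim c (fun i => Pi.single i 1) (s j)) ∧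
      ∃ t : Set (Fin m), (∀ j ∈ t, ∃ i, s j = Sum.inl i) ∧ ∀ i, c i ∈ Submodule.span ℝ (B '' t) := by
  set w : Fin n ⊕ Fin m → Fin m → ℝ := Sum.elim c (fun i => Pi.single i 1)
  obtain ⟨b₁, hb₁, -, hspan₁, hli₁⟩ := exists_linearIndepOn_extension
    (linearIndepOn_empty ℝ w) (Set.empty_subset (Set.range Sum.inl))
  obtain ⟨b, -, hbb, hspan, hli⟩ := exists_linearIndepOn_extension hli₁ (Set.subset_univ b₁)
  have htop : ⊤ ≤ Submodule.span ℝ (Set.range fun x : b => w x) := by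
    rw [← (Pi.basisFun ℝ (Fin m)).span_eq, Submodule.span_le]
    rintro _ ⟨i, rfl⟩
    have := hspan ⟨Sum.inr i, Set.mem_univ _, rfl⟩
    rw [Set.image_eq_range] at this
    simpa [w] using this
  let B₀ := Module.Basis.mk hli htop
  let e : b ≃ Fin m := B₀.indexEquiv (Pi.basisFun ℝ (Fin m))
  have hB : ∀ j, B₀.reindex e j = w (e.symm j) := fun j => by
    rw [Module.Basis.reindex_apply]
    exact Module.Basis.mk_apply hli htop _
  refine ⟨fun j => e.symm j, B₀.reindex e, Subtype.val_injective.comp e.symm.injective, hB,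
    {j | (e.symm j : Fin n ⊕ Fin m) ∈ b₁}, fun j hj => ?_, fun i => ?_⟩
  · obtain ⟨i, hi⟩ := hb₁ hj
    exact ⟨i, hi.symm⟩
  · refine Submodule.span_mono ?_ (hspan₁ ⟨Sum.inl i, ⟨i, rfl⟩, rfl⟩)
    rintro _ ⟨x, hx, rfl⟩
    exact ⟨e ⟨x, hbb hx⟩, by simpa using hx, by simp [hB]⟩

/-- If `x` lies in a lattice `N` with `N ∩ L_ℚ ⊆ L`, the torsion of the quotient by `L` injects into
the quotient by `N`. -/
theorem torsion_quotient_finite_and_card_le {E : Type*} [AddCommGroup E] (L N : Submodule ℤ E)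
    [Finite (E ⧸ N)] (h : ∀ x ∈ N, ∀ k : ℕ, k ≠ 0 → k • x ∈ L → x ∈ L) :
    Finite (AddCommGroup.torsion (E ⧸ L)) ∧
      Nat.card (AddCommGroup.torsion (E ⧸ L)) ≤ Nat.card (E ⧸ N) := by
  let g : AddCommGroup.torsion (E ⧸ L) → E ⧸ N :=
    fun t => Submodule.Quotient.mk (Quotient.out (t : E ⧸ L))
  have hg : Function.Injective g := by
    intro t u htu
    have hN := (Submodule.Quotient.eq N).1 htu
    have hout : ∀ q : E ⧸ L, (Submodule.Quotient.mk (Quotient.out q) : E ⧸ L) = q :=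
      fun q => Quotient.out_eq q
    obtain ⟨k, hk, hkt⟩ := isOfFinAddOrder_iff_nsmul_eq_zero.1 (t - u).2
    have hL := h _ hN k hk.ne' <| (Submodule.Quotient.mk_eq_zero L).1 <| by
      rw [Submodule.Quotient.mk_smul, Submodule.Quotient.mk_sub, hout, hout]
      exact hkt
    have := (Submodule.Quotient.eq L).2 hL
    rw [hout, hout] at this
    exact Subtype.ext this
  exact ⟨Finite.of_injective g hg, Nat.card_le_card_of_injective g hg⟩


/-- Quantitative consequence of Gabber's lemma (Lemma 5.2 of the paper): if every
column of the integer matrix `M` has Euclidean norm at most `K ≥ 1`, then the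
torsion subgroup of the cokernel of `f : ℤⁿ → ℤᵐ, v ↦ M·v` is finite of
cardinality at most `Kⁿ`. -/
theorem stmt_1 (m n : ℕ) (M : Matrix (Fin m) (Fin n) ℤ) (K : ℝ) (hK : 1 ≤ K)
    (hcol : ∀ i : Fin n, Real.sqrt (∑ j, (M j i : ℝ) ^ 2) ≤ K) :
    (↑(AddCommGroup.torsion ((Fin m → ℤ) ⧸ LinearMap.range (Matrix.mulVecLin M))) :
        Set ((Fin m → ℤ) ⧸ LinearMap.range (Matrix.mulVecLin M))).Finite ∧
    (Nat.card (AddCommGroup.torsion ((Fin m → ℤ) ⧸ LinearMap.range (Matrix.mulVecLin M))) : ℝ)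
      ≤ K ^ n := by
  set c : Fin n → Fin m → ℤ := fun i j => M j i with hc
  obtain ⟨s, B, hs, hB, t, ht, hspan⟩ := exists_basis_extending_columns fun i j => (c i j : ℝ)
  let A : Matrix (Fin m) (Fin m) ℤ := fun j => Sum.elim c (fun i => Pi.single i 1) (s j)
  have hAB : ∀ j, B j = fun i => (A j i : ℝ) := by
    intro j
    rw [hB]
    ext i
    rcases hj : s j with a | a <;> simp [A, hj, Pi.single_apply]
  have hdet : (A.det : ℝ) = (Pi.basisFun ℝ (Fin m)).det B := by
    rw [Pi.basisFun_det_apply, Int.cast_det]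
    congr 1
    ext j i
    simp [hAB]
  have hdet0 : A.det ≠ 0 := by
    have := ((Pi.basisFun ℝ (Fin m)).isUnit_det B).ne_zero
    rw [← hdet] at this
    exact_mod_cast this
  have hbound : (A.det.natAbs : ℝ) ≤ K ^ n := by
    have h := Matrix.abs_det_le_prod_sqrt (A.map (Int.cast : ℤ → ℝ))
    rw [← Int.cast_det] at h
    have hrow : ∀ j, Real.sqrt (∑ i, (A j i : ℝ) ^ 2) ≤
        Sum.elim (fun _ : Fin n => K) (fun _ : Fin m => 1) (s j) := by
      intro j
      rcases hj : s j with a | a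
      · simpa [A, hj, c] using hcol a
      · simp [A, hj, Pi.single_apply]
    rw [Nat.cast_natAbs, Int.cast_abs]
    calc |(A.det : ℝ)| ≤ ∏ j, Real.sqrt (∑ i, (A j i : ℝ) ^ 2) := by simpa using h
      _ ≤ ∏ j, Sum.elim (fun _ : Fin n => K) (fun _ : Fin m => 1) (s j) :=
        Finset.prod_le_prod (fun _ _ => Real.sqrt_nonneg _) fun j _ => hrow j
      _ = ∏ x ∈ Finset.univ.map ⟨s, hs⟩, Sum.elim (fun _ : Fin n => K) (fun _ : Fin m => 1) x := by
        simp
      _ ≤ ∏ x, Sum.elim (fun _ : Fin n => K) (fun _ : Fin m => (1 : ℝ)) x := by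
        refine Finset.prod_le_prod_of_subset_of_one_le (Finset.subset_univ _) ?_ ?_
        · rintro (a | a) - <;> simp [zero_le_one.trans hK]
        · rintro (a | a) - - <;> simp [hK]
      _ = K ^ n := by simp
  have hli : LinearIndependent ℤ A := Matrix.linearIndependent_rows_of_det_ne_zero hdet0
  let N := Submodule.span ℤ (Set.range A)
  have hcard : Nat.card ((Fin m → ℤ) ⧸ N) = A.det.natAbs := by
    rw [← Submodule.natAbs_det_basis_change (Pi.basisFun ℤ (Fin m)) N (Module.Basis.span hli),
      Pi.basisFun_det_apply]
    congr 2
    ext j i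
    exact congrFun (congrArg Subtype.val (Module.Basis.span_apply hli j)) i
  have : Finite ((Fin m → ℤ) ⧸ N) :=
    Nat.finite_of_card_ne_zero (by rw [hcard]; exact Int.natAbs_ne_zero.2 hdet0)
  have key : ∀ x ∈ N, ∀ k : ℕ, k ≠ 0 → k • x ∈ LinearMap.range M.mulVecLin →
      x ∈ LinearMap.range M.mulVecLin := by
    intro x hx k hk hkx
    obtain ⟨a, rfl⟩ := (Submodule.mem_span_range_iff_exists_fun ℤ).1 hx
    obtain ⟨y, hy⟩ := hkx
    have hmem : ∑ j, ((k : ℝ) * a j) • B j ∈ Submodule.span ℝ (B '' t) := by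
      have : ∑ j, ((k : ℝ) * a j) • B j = ∑ i, (y i : ℝ) • fun j => (c i j : ℝ) := by
        ext l
        have := congrArg (Int.cast : ℤ → ℝ) (congrFun hy l)
        simp only [Matrix.mulVecLin_apply, Matrix.mulVec, dotProduct, Int.cast_sum, Int.cast_mul,
          Pi.smul_apply, Finset.sum_apply, smul_eq_mul, nsmul_eq_mul, Int.cast_natCast] at this
        simp only [Finset.sum_apply, Pi.smul_apply, smul_eq_mul, hAB, hc, mul_assoc,
          ← Finset.mul_sum]
        rw [← this]
        exact Finset.sum_congr rfl fun _ _ => mul_comm _ _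
      rw [this]
      exact Submodule.sum_mem _ fun i _ => Submodule.smul_mem _ _ (hspan i)
    rw [B.mem_span_image] at hmem
    refine Submodule.sum_mem _ fun j _ => ?_
    by_cases hj : a j = 0
    · simp [hj]
    · have hjt : j ∈ t := hmem <| by
        rw [Finset.mem_coe, Finsupp.mem_support_iff, B.repr_sum_self]
        exact mul_ne_zero (by exact_mod_cast hk) (by exact_mod_cast hj)
      obtain ⟨i, hi⟩ := ht j hjt
      refine Submodule.smul_mem _ _ ⟨Pi.single i 1, ?_⟩
      ext l
      simp [A, hi, c]
  obtain ⟨hfin, hle⟩ := torsion_quotient_finite_and_card_le _ N key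
  refine ⟨Set.toFinite _, le_trans ?_ hbound⟩
  rw [← hcard]
  exact_mod_cast hle
end

section
/- Let N be a nilpotent group acting on a metric space X by isometries, i.e. dist(γ • y, γ • z) = dist(y, z) for all γ ∈ N and y, z ∈ X. For γ ∈ N with γ ≠ 1, let i(γ) denote the least natural number i such that γ lies in the (i+1)-st term of the upper central series of N (so i(γ) = 0 exactly when γ is central); nilpotency guarantees i(γ) is well defined. Let ε₀ > 0, let x ∈ X, and let α, β ∈ N be elements with ⁅α,β⁆ = αβα⁻¹β⁻¹ ≠ 1 such that dist(x, α • x) ≤ ε₀/17^{i(α)} and dist(x, β • x) ≤ ε₀/17^{i(β)}. Then dist(x, ⁅α,β⁆ • x) < ε₀/(4·17^{i(⁅α,β⁆)}). -/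
/-- The displacement of a commutator of isometries is at most twice the sum of the displacements. -/
theorem dist_commutator_smul_le {N X : Type*} [Group N] [MetricSpace X] [MulAction N X]
    (hiso : ∀ (γ : N) (y z : X), dist (γ • y) (γ • z) = dist y z) (x : X) (α β : N) :
    dist x ((α * β * α⁻¹ * β⁻¹) • x) ≤ 2 * dist x (α • x) + 2 * dist x (β • x) := by
  have hmul (γ δ : N) : dist x ((γ * δ) • x) ≤ dist x (γ • x) + dist x (δ • x) := by
    rw [mul_smul, ← hiso γ x (δ • x)]
    exact dist_triangle _ _ _
  have hinv (γ : N) : dist x (γ⁻¹ • x) = dist x (γ • x) := by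
    rw [← hiso γ x (γ⁻¹ • x), smul_inv_smul, dist_comm]
  linarith [hmul (α * β * α⁻¹) β⁻¹, hmul (α * β) α⁻¹, hmul α β, hinv α, hinv β]

/-- The commutator with an element of the `(n + 1)`-st term of the upper central series lies in
the `n`-th term. -/
theorem commutator_mem_upperCentralSeries_left {N : Type*} [Group N] {n : ℕ} {α : N}
    (h : α ∈ Subgroup.upperCentralSeries N (n + 1)) (β : N) :
    α * β * α⁻¹ * β⁻¹ ∈ Subgroup.upperCentralSeries N n :=
  Subgroup.mem_upperCentralSeries_succ_iff.mp h β

/-- The commutator with an element of the `(n + 1)`-st term of the upper central series lies in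
the `n`-th term. -/
theorem commutator_mem_upperCentralSeries_right {N : Type*} [Group N] {n : ℕ} (α : N) {β : N}
    (h : β ∈ Subgroup.upperCentralSeries N (n + 1)) :
    α * β * α⁻¹ * β⁻¹ ∈ Subgroup.upperCentralSeries N n := by
  simpa [mul_assoc] using inv_mem (commutator_mem_upperCentralSeries_left h α)


/-- Key estimate in the proof of Theorem 4.1 of the paper: for a nilpotent
group `N` acting isometrically on a metric space, elements `α, β` with
`⁅α,β⁆ ≠ 1` and displacements `d_α(x) ≤ ε₀/17^{i(α)}`, `d_β(x) ≤ ε₀/17^{i(β)}`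
satisfy `d_{⁅α,β⁆}(x) < ε₀/(4·17^{i(⁅α,β⁆)})`, where `i(γ)` is the least `i`
with `γ` in the `(i+1)`-st term of the upper central series of `N`. -/
theorem stmt_9 {N X : Type*} [Group N] [Group.IsNilpotent N] [MetricSpace X] [MulAction N X]
    (hiso : ∀ (γ : N) (y z : X), dist (γ • y) (γ • z) = dist y z)
    (ε₀ : ℝ) (hε₀ : 0 < ε₀) (x : X) (α β : N)
    (hc : α * β * α⁻¹ * β⁻¹ ≠ 1)
    (iα iβ ic : ℕ)
    (hiα : α ∈ upperCentralSeries N (iα + 1) ∧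
      ∀ j : ℕ, α ∈ upperCentralSeries N (j + 1) → iα ≤ j)
    (hiβ : β ∈ upperCentralSeries N (iβ + 1) ∧
      ∀ j : ℕ, β ∈ upperCentralSeries N (j + 1) → iβ ≤ j)
    (hic : α * β * α⁻¹ * β⁻¹ ∈ upperCentralSeries N (ic + 1) ∧
      ∀ j : ℕ, α * β * α⁻¹ * β⁻¹ ∈ upperCentralSeries N (j + 1) → ic ≤ j)
    (hα : dist x (α • x) ≤ ε₀ / 17 ^ iα)
    (hβ : dist x (β • x) ≤ ε₀ / 17 ^ iβ) :
    dist x ((α * β * α⁻¹ * β⁻¹) • x) < ε₀ / (4 * 17 ^ ic) := by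
  have hlt (i : ℕ) (h : α * β * α⁻¹ * β⁻¹ ∈ Subgroup.upperCentralSeries N i) : ic + 1 ≤ i := by
    cases i with
    | zero => exact absurd (Subgroup.mem_bot.mp h) hc
    | succ j => exact Nat.succ_le_succ (hic.2 j h)
  have hbound (i : ℕ) (hi : ic + 1 ≤ i) : ε₀ / 17 ^ i ≤ ε₀ / 17 ^ (ic + 1) := by
    gcongr
    norm_num
  have h₁ := hbound iα (hlt iα (commutator_mem_upperCentralSeries_left hiα.1 β))
  have h₂ := hbound iβ (hlt iβ (commutator_mem_upperCentralSeries_right α hiβ.1))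
  calc dist x ((α * β * α⁻¹ * β⁻¹) • x)
      ≤ 2 * dist x (α • x) + 2 * dist x (β • x) := dist_commutator_smul_le hiso x α β
    _ ≤ 4 * (ε₀ / 17 ^ (ic + 1)) := by linarith
    _ = 16 / 17 * (ε₀ / (4 * 17 ^ ic)) := by field_simp; ring
    _ < ε₀ / (4 * 17 ^ ic) := by
      have : 0 < ε₀ / (4 * 17 ^ ic) := by positivity
      linarith
end

section
/- For all real numbers α > 0 and β > 0 and every natural number d, there exists δ₀ > 0 with the following property. Let E = EuclideanSpace ℝ (Fin d), let 0 < δ ≤ δ₀, let c, x, y ∈ E with dist(c, x) = α (so x lies on the boundary sphere of the closed ball C of radius α around c), dist(x, y) ≤ δβ, and y ∉ cthickening (δ/2) C (i.e. infDist(y, C) > δ/2). Then the inner product ⟪x − c, y − x⟫ is strictly positive. -/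
open scoped RealInnerProductSpace

/-- Flat case of Lemma 4.5 of the paper: for all `α, β > 0` and dimension `d`
there is `δ₀ > 0` such that for `0 < δ ≤ δ₀`, any point `x` on the boundary of
the closed ball `C` of radius `α` around `c`, and any `y` with
`dist(x,y) ≤ δβ` lying outside the closed `δ/2`-neighborhood of `C`, the inner
product of the external normal `x − c` with `y − x` is positive. -/
theorem stmt_10 (α β : ℝ) (hα : 0 < α) (hβ : 0 < β) (d : ℕ) :
    ∃ δ₀ > 0, ∀ δ : ℝ, 0 < δ → δ ≤ δ₀ →
      ∀ c x y : EuclideanSpace ℝ (Fin d),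
        dist c x = α → dist x y ≤ δ * β →
        y ∉ Metric.cthickening (δ / 2) (Metric.closedBall c α) →
        0 < ⟪x - c, y - x⟫ := by
  refine ⟨α / β ^ 2, by positivity, fun δ hδ hδ₀ c x y hcx hxy hy => ?_⟩
  rw [cthickening_closedBall (by positivity) hα.le, Metric.mem_closedBall, not_le,
    dist_eq_norm] at hy
  rw [dist_comm, dist_eq_norm] at hcx hxy
  rw [le_div_iff₀ (by positivity)] at hδ₀
  have expand : ‖y - c‖ ^ 2 = α ^ 2 + 2 * ⟪x - c, y - x⟫ + ‖y - x‖ ^ 2 := by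
    rw [← hcx, ← norm_add_sq_real, add_comm (x - c), sub_add_sub_cancel]
  have lower : (δ / 2 + α) ^ 2 < ‖y - c‖ ^ 2 := by gcongr
  have upper : ‖y - x‖ ^ 2 ≤ (δ * β) ^ 2 := by gcongr
  have small : (δ * β) ^ 2 ≤ δ * α := by
    calc (δ * β) ^ 2 = δ * (δ * β ^ 2) := by ring
      _ ≤ δ * α := by gcongr
  nlinarith [sq_pos_of_pos hδ]
end

section
/- Let E be a real inner product space, let Ω ⊆ E be a nonempty convex subset, and let α : E → E be a bijective affine isometry with α(Ω) = Ω. Let x ∈ Ω and u ∈ E be such that for every t ≥ 0 the point x is a nearest point of Ω to x + t·u, i.e. dist(x + t·u, x) ≤ dist(x + t·u, y) for all y ∈ Ω. Then the displacement along the ray is monotone: for all 0 ≤ s ≤ t, dist(x + s·u, α(x + s·u)) ≤ dist(x + t·u, α(x + t·u)). -/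
/-- If `x` is a nearest point of `Ω` to every point of the ray `x + t • u`, `t ≥ 0`, then `u` is
an outward normal to `Ω` at `x`. -/
theorem inner_sub_nonpos_of_forall_dist_ray_le {E : Type*} [NormedAddCommGroup E]
    [InnerProductSpace ℝ E] {Ω : Set E} {x u : E}
    (h : ∀ t : ℝ, 0 ≤ t → ∀ y ∈ Ω, dist (x + t • u) x ≤ dist (x + t • u) y)
    {y : E} (hy : y ∈ Ω) : inner ℝ u (y - x) ≤ 0 := by
  have key : ∀ t : ℝ, 0 ≤ t → 2 * t * inner ℝ u (y - x) ≤ ‖y - x‖ ^ 2 := by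
    intro t ht
    have h1 := h t ht y hy
    rw [dist_eq_norm, dist_eq_norm, add_sub_cancel_left,
      show x + t • u - y = t • u - (y - x) by abel] at h1
    have h2 := pow_le_pow_left₀ (norm_nonneg _) h1 2
    rw [norm_sub_sq_real, real_inner_smul_left] at h2
    linarith
  by_contra! hpos
  have h3 := key ((‖y - x‖ ^ 2 + 1) / inner ℝ u (y - x)) (by positivity)
  rw [mul_assoc, div_mul_cancel₀ _ hpos.ne'] at h3
  nlinarith [sq_nonneg ‖y - x‖]

/-- If `v` makes a nonobtuse angle with `w`, then the norm is monotone along the ray from `w` in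
direction `v`. -/
theorem norm_add_smul_le_norm_add_smul_of_inner_nonneg {E : Type*} [NormedAddCommGroup E]
    [InnerProductSpace ℝ E] {w v : E} (h : 0 ≤ inner ℝ w v) {s t : ℝ} (hs : 0 ≤ s)
    (hst : s ≤ t) : ‖w + s • v‖ ≤ ‖w + t • v‖ := by
  refine (sq_le_sq₀ (norm_nonneg _) (norm_nonneg _)).mp ?_
  rw [norm_add_sq_real, norm_add_sq_real, real_inner_smul_right, real_inner_smul_right,
    norm_smul_of_nonneg hs, norm_smul_of_nonneg (hs.trans hst)]
  gcongr

/-- Flat case of Lemma 3.6 of the paper: let `Ω` be a nonempty convex subset of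
a real inner product space preserved by a bijective affine isometry `α`, let
`x ∈ Ω` and let `u` be a direction such that `x` is a nearest point of `Ω` to
every point `x + t·u` of the outward ray. Then the displacement
`t ↦ dist(x + t·u, α(x + t·u))` is monotone nondecreasing on `[0,∞)`. -/
theorem stmt_11 {E : Type*} [NormedAddCommGroup E] [InnerProductSpace ℝ E]
    (Ω : Set E) (hne : Ω.Nonempty) (hconv : Convex ℝ Ω)
    (α : E ≃ᵃⁱ[ℝ] E) (hα : α '' Ω = Ω)
    (x : E) (hx : x ∈ Ω) (u : E)
    (hproj : ∀ t : ℝ, 0 ≤ t → ∀ y ∈ Ω, dist (x + t • u) x ≤ dist (x + t • u) y)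
    (s t : ℝ) (hs : 0 ≤ s) (hst : s ≤ t) :
    dist (x + s • u) (α (x + s • u)) ≤ dist (x + t • u) (α (x + t • u)) := by
  have displacement_eq (r : ℝ) : dist (x + r • u) (α (x + r • u)) =
      ‖(x - α x) + r • (u - α.linearIsometryEquiv u)‖ := by
    have hr : α (x + r • u) = r • α.linearIsometryEquiv u + α x := by
      simpa [add_comm] using α.map_vadd x (r • u)
    rw [dist_eq_norm, hr, smul_sub]
    congr 1
    abel
  rw [displacement_eq, displacement_eq]
  refine norm_add_smul_le_norm_add_smul_of_inner_nonneg ?_ hs hst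
  have h_image : inner ℝ u (α x - x) ≤ 0 :=
    inner_sub_nonpos_of_forall_dist_ray_le hproj (hα ▸ Set.mem_image_of_mem α hx)
  obtain ⟨y, hy, hyx⟩ : x ∈ α '' Ω := hα.symm ▸ hx
  have h_preimage : inner ℝ (x - α x) (α.linearIsometryEquiv u) ≤ 0 := by
    have hlin : x - α x = α.linearIsometryEquiv (y - x) := by
      simpa [hyx] using (α.map_vsub y x).symm
    rw [hlin, LinearIsometryEquiv.inner_map_map, real_inner_comm]
    exact inner_sub_nonpos_of_forall_dist_ray_le hproj hy
  have h_swap : inner ℝ (x - α x) u = -inner ℝ u (α x - x) := by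
    rw [real_inner_comm, ← inner_neg_right, neg_sub]
  rw [inner_sub_right, h_swap]
  linarith
end
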